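/- Suppose (i) KEM one-time security: SD(real view, ideal view) ≤ ε, where the real view is the distribution of (z, c₁, k) obtained by sampling (x, y, z) ← Gen and (c₁, k) ← Encap(x), and the ideal view replaces k by an independent uniform u ← U on K; and (ii) DEM one-time information-theoretic security: for all messages m₀, m₁ ∈ M, the statistical distance between the ciphertext distributions obtained by sampling k ← U and c₂ ← DEnc(k, m₀), respectively c₂ ← DEnc(k, m₁), is at most σ. Then the hybrid encryption is one-time secure with bound 2ε + σ: for all message-selection functions m₀, m₁ : Z → M, the statistical distance between the distribution of (z, c₁, c₂) obtained by sampling (x, y, z) ← Gen, (c₁, k) ← Encap(x), c₂ ← DEnc(k, m₀(z)), and the corresponding distribution with m₁ in place of m₀, is at most 2ε + σ. -/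

import Mathlib

/-- The statistical distance between two real-valued mass functions on a finite type. -/
noncomputable def SD {α : Type*} [Fintype α] (P Q : α → ℝ) : ℝ :=
  (1 / 2) * ∑ x, |P x - Q x|

/-- The real view `(z, c₁, k)` of a one-time KEM adversary: sample `(x, y, z) ← Gen`
and `(c₁, k) ← Encap x`. -/
noncomputable def realView {X Y Z C₁ K : Type*} [Fintype X] [Fintype Y]
    (Gen : X × Y × Z → ℝ) (Encap : X → C₁ × K → ℝ) : Z × C₁ × K → ℝ :=
  fun p => ∑ x, ∑ y, Gen (x, y, p.1) * Encap x (p.2.1, p.2.2)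

/-- The ideal view `(z, c₁, u)`: as the real view but with the key replaced by an
independent uniform `u ← U` on `K`. -/
noncomputable def idealView {X Y Z C₁ K : Type*} [Fintype X] [Fintype Y] [Fintype K]
    (Gen : X × Y × Z → ℝ) (Encap : X → C₁ × K → ℝ) : Z × C₁ × K → ℝ :=
  fun p =>
    (∑ x, ∑ y, ∑ k, Gen (x, y, p.1) * Encap x (p.2.1, k)) * (1 / (Fintype.card K : ℝ))

/-- The hybrid-encryption view `(z, c₁, c₂)` for a message-selection function `m`:
sample `(x, y, z) ← Gen`, `(c₁, k) ← Encap x`, `c₂ ← DEnc k (m z)`. -/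
noncomputable def hybridView {X Y Z C₁ K C₂ M : Type*} [Fintype X] [Fintype Y]
    [Fintype K] (Gen : X × Y × Z → ℝ) (Encap : X → C₁ × K → ℝ)
    (DEnc : K → M → C₂ → ℝ) (m : Z → M) : Z × C₁ × C₂ → ℝ :=
  fun p => ∑ x, ∑ y, ∑ k, Gen (x, y, p.1) * Encap x (p.2.1, k) * DEnc k (m p.1) p.2.2

theorem SD_triangle {α : Type*} [Fintype α] (P Q R : α → ℝ) : SD P R ≤ SD P Q + SD Q R := by
  unfold SD
  rw [← mul_add, ← Finset.sum_add_distrib]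
  gcongr with x
  exact abs_sub_le _ _ _

theorem SD_comm {α : Type*} [Fintype α] (P Q : α → ℝ) : SD P Q = SD Q P := by
  simp only [SD, abs_sub_comm]

/-- Process the last coordinate `k` of a mass function on `Z × C × K` by a kernel that may depend
on the first coordinate. -/
noncomputable def processKey {Z C K B : Type*} [Fintype K] (D : Z → K → B → ℝ)
    (P : Z × C × K → ℝ) : Z × C × B → ℝ :=
  fun p => ∑ k, P (p.1, p.2.1, k) * D p.1 k p.2.2

/-- Data processing inequality for the statistical distance. -/
theorem SD_processKey_le {Z C K B : Type*} [Fintype Z] [Fintype C] [Fintype K] [Fintype B]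
    (D : Z → K → B → ℝ) (hD0 : ∀ z k b, 0 ≤ D z k b) (hD1 : ∀ z k, ∑ b, D z k b = 1)
    (P Q : Z × C × K → ℝ) : SD (processKey D P) (processKey D Q) ≤ SD P Q := by
  unfold SD processKey
  simp only [Fintype.sum_prod_type]
  gcongr with z _ c _
  calc ∑ b, |∑ k, P (z, c, k) * D z k b - ∑ k, Q (z, c, k) * D z k b|
      ≤ ∑ b, ∑ k, |P (z, c, k) - Q (z, c, k)| * D z k b := by
        gcongr with b
        rw [← Finset.sum_sub_distrib]
        refine (Finset.abs_sum_le_sum_abs _ _).trans_eq (Finset.sum_congr rfl fun k _ => ?_)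
        rw [← sub_mul, abs_mul, abs_of_nonneg (hD0 z k b)]
    _ = ∑ k, |P (z, c, k) - Q (z, c, k)| := by
        rw [Finset.sum_comm]
        simp only [← Finset.mul_sum, hD1, mul_one]

/-- A mixture of pairs of mass functions at statistical distance at most `σ` keeps that bound. -/
theorem SD_mixture_le {Z C B : Type*} [Fintype Z] [Fintype C] [Fintype B]
    (w : Z → C → ℝ) (hw0 : ∀ z c, 0 ≤ w z c) (hw1 : ∑ z, ∑ c, w z c = 1)
    (P Q : Z → B → ℝ) {σ : ℝ} (h : ∀ z, SD (P z) (Q z) ≤ σ) :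
    SD (fun p : Z × C × B => w p.1 p.2.1 * P p.1 p.2.2)
      (fun p => w p.1 p.2.1 * Q p.1 p.2.2) ≤ σ := by
  calc _ = ∑ z, ∑ c, w z c * SD (P z) (Q z) := by
        simp only [SD, Fintype.sum_prod_type, ← mul_sub, abs_mul, Finset.mul_sum]
        refine Finset.sum_congr rfl fun z _ => Finset.sum_congr rfl fun c _ =>
          Finset.sum_congr rfl fun b _ => ?_
        rw [abs_of_nonneg (hw0 z c)]
        ring
    _ ≤ ∑ z, ∑ c, w z c * σ := by
        gcongr with z _ c _
        · exact hw0 z c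
        · exact h z
    _ = σ := by simp only [← Finset.sum_mul, hw1, one_mul]

theorem hybridView_eq_processKey {X Y Z C₁ K C₂ M : Type*} [Fintype X] [Fintype Y] [Fintype K]
    (Gen : X × Y × Z → ℝ) (Encap : X → C₁ × K → ℝ) (DEnc : K → M → C₂ → ℝ) (m : Z → M) :
    hybridView Gen Encap DEnc m =
      processKey (fun z k => DEnc k (m z)) (realView Gen Encap) := by
  funext p
  simp only [hybridView, processKey, realView, Finset.sum_mul]
  rw [Finset.sum_comm (s := (Finset.univ : Finset K))]
  exact Finset.sum_congr rfl fun x _ => Finset.sum_comm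

theorem processKey_idealView {X Y Z C₁ K B : Type*} [Fintype X] [Fintype Y] [Fintype K]
    (Gen : X × Y × Z → ℝ) (Encap : X → C₁ × K → ℝ) (D : Z → K → B → ℝ) :
    processKey D (idealView Gen Encap) = fun p =>
      (∑ x, ∑ y, ∑ k, Gen (x, y, p.1) * Encap x (p.2.1, k)) *
        ∑ k, (1 / (Fintype.card K : ℝ)) * D p.1 k p.2.2 := by
  funext p
  simp only [processKey, idealView, mul_assoc, ← Finset.mul_sum]

/-- The pair `(z, c₁)` has total mass one. -/
theorem sum_Gen_mul_Encap {X Y Z C₁ K : Type*} [Fintype X] [Fintype Y] [Fintype Z]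
    [Fintype C₁] [Fintype K] (Gen : X × Y × Z → ℝ) (Encap : X → C₁ × K → ℝ)
    (hGen1 : ∑ p, Gen p = 1) (hEnc1 : ∀ x, ∑ q, Encap x q = 1) :
    ∑ z, ∑ c, ∑ x, ∑ y, ∑ k, Gen (x, y, z) * Encap x (c, k) = 1 := by
  simp only [Fintype.sum_prod_type] at hGen1 hEnc1
  calc _ = ∑ z, ∑ x, ∑ y, Gen (x, y, z) * ∑ c, ∑ k, Encap x (c, k) := by
        refine Finset.sum_congr rfl fun z _ => ?_
        rw [Finset.sum_comm]
        refine Finset.sum_congr rfl fun x _ => ?_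
        rw [Finset.sum_comm]
        simp only [Finset.mul_sum]
    _ = 1 := by
        simp only [hEnc1, mul_one]
        rw [Finset.sum_comm, ← hGen1]
        exact Finset.sum_congr rfl fun x _ => Finset.sum_comm

/-- Composition theorem (classical core of the qHE composition theorem):
if the KEM real and ideal views are within statistical distance `ε`, and the DEM is
one-time secure with bound `σ` under a uniform key, then for any two message-selection
functions the hybrid-encryption views are within statistical distance `2ε + σ`. -/
theorem hybrid_encryption_composition
    {X Y Z C₁ K C₂ M : Type*} [Fintype X] [Fintype Y] [Fintype Z] [Fintype C₁]
    [Fintype K] [Fintype C₂] [Fintype M] [Nonempty K]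
    (Gen : X × Y × Z → ℝ) (Encap : X → C₁ × K → ℝ) (DEnc : K → M → C₂ → ℝ)
    (ε σ : ℝ)
    (hGen0 : ∀ p, 0 ≤ Gen p) (hGen1 : ∑ p, Gen p = 1)
    (hEnc0 : ∀ x q, 0 ≤ Encap x q) (hEnc1 : ∀ x, ∑ q, Encap x q = 1)
    (hD0 : ∀ k m c₂, 0 ≤ DEnc k m c₂) (hD1 : ∀ k m, ∑ c₂, DEnc k m c₂ = 1)
    (hKEM : SD (realView Gen Encap) (idealView Gen Encap) ≤ ε)
    (hDEM : ∀ m₀ m₁ : M,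
      SD (fun c₂ => ∑ k, (1 / (Fintype.card K : ℝ)) * DEnc k m₀ c₂)
         (fun c₂ => ∑ k, (1 / (Fintype.card K : ℝ)) * DEnc k m₁ c₂) ≤ σ) :
    ∀ m₀ m₁ : Z → M,
      SD (hybridView Gen Encap DEnc m₀) (hybridView Gen Encap DEnc m₁)
        ≤ 2 * ε + σ := by
  intro m₀ m₁
  have hreal (m : Z → M) : SD (hybridView Gen Encap DEnc m)
      (processKey (fun z k => DEnc k (m z)) (idealView Gen Encap)) ≤ ε := by
    rw [hybridView_eq_processKey]
    exact (SD_processKey_le _ (fun z k => hD0 k (m z)) (fun z k => hD1 k (m z)) _ _).trans hKEM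
  have hideal : SD (processKey (fun z k => DEnc k (m₀ z)) (idealView Gen Encap))
      (processKey (fun z k => DEnc k (m₁ z)) (idealView Gen Encap)) ≤ σ := by
    simp only [processKey_idealView]
    exact SD_mixture_le (fun z c => ∑ x, ∑ y, ∑ k, Gen (x, y, z) * Encap x (c, k))
      (fun z c => Finset.sum_nonneg fun x _ => Finset.sum_nonneg fun y _ =>
        Finset.sum_nonneg fun k _ => mul_nonneg (hGen0 _) (hEnc0 _ _))
      (sum_Gen_mul_Encap Gen Encap hGen1 hEnc1)
      (fun z c₂ => ∑ k, (1 / (Fintype.card K : ℝ)) * DEnc k (m₀ z) c₂)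
      (fun z c₂ => ∑ k, (1 / (Fintype.card K : ℝ)) * DEnc k (m₁ z) c₂)
      fun z => hDEM (m₀ z) (m₁ z)
  have h₁ := hreal m₁
  rw [SD_comm] at h₁
  linarith [hreal m₀, SD_triangle (hybridView Gen Encap DEnc m₀)
      (processKey (fun z k => DEnc k (m₀ z)) (idealView Gen Encap))
      (hybridView Gen Encap DEnc m₁),
    SD_triangle (processKey (fun z k => DEnc k (m₀ z)) (idealView Gen Encap))
      (processKey (fun z k => DEnc k (m₁ z)) (idealView Gen Encap))
      (hybridView Gen Encap DEnc m₁)]
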